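/- Proposition 2 (monotonicity of three-point curvatures on a spiral): Let γ be a unit-speed plane curve whose signed curvature k is nondecreasing on [s₁, s₄], let s₁ < s₂ < s₃ < s₄, set Pᵢ = γ(sᵢ) (pairwise distinct), and vᵢ = P_{i+1} − Pᵢ. Assume each of the three arcs is one-to-one projectable onto its chord (⟨γ'(s), vᵢ/‖vᵢ‖⟩ > 0 for s ∈ [s_i, s_{i+1}], i = 1, 2, 3), and assume the turning-angle constraints ‖v₁‖² + ⟨v₁, v₂⟩ ≥ 0 and ‖v₃‖² + ⟨v₂, v₃⟩ ≥ 0 (no arc of the circles P₁P₂P₃ and P₂P₃P₄ between consecutive nodes exceeds 180°). Then the signed three-point curvatures are ordered: q(P₁, P₂, P₃) ≤ q(P₂, P₃, P₄). -/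

import Mathlib

open scoped InnerProductSpace

/-- Planar cross product: `det((a₁,a₂),(b₁,b₂)) = a₁·b₂ − a₂·b₁`. -/
noncomputable def det2 (a b : EuclideanSpace ℝ (Fin 2)) : ℝ :=
  a 0 * b 1 - a 1 * b 0

/-- Signed curvature of a unit-speed plane curve: `k(s) = det(γ'(s), γ''(s))`. -/
noncomputable def signedCurv (γ : ℝ → EuclideanSpace ℝ (Fin 2)) (s : ℝ) : ℝ :=
  det2 (deriv γ s) (deriv (deriv γ) s)

/-- Signed curvature of the directed circle through three pairwise distinct
points `A`, `B`, `C`. -/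
noncomputable def q3 (A B C : EuclideanSpace ℝ (Fin 2)) : ℝ :=
  2 * det2 (B - A) (C - B) / (‖B - A‖ * ‖C - B‖ * ‖C - A‖)

/-- The sine is strictly monotone on angles with nonnegative cosine, stated for points
`(c, b)` and `(d, t)` of the unit circle. -/
lemma mul_lt_mul_of_unit_circle {b c t d : ℝ} (hbc : c ^ 2 + b ^ 2 = 1)
    (htd : d ^ 2 + t ^ 2 = 1) (hc : 0 < c) (hd : 0 ≤ d) (hbt : b < t) : d * b < t * c := by
  rcases le_or_gt 0 b with hb | hb
  · have hdc : d ≤ c := by nlinarith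
    nlinarith
  · rcases le_or_gt 0 t with ht | ht
    · rcases hd.eq_or_lt with rfl | hd
      · have : 0 < t := by nlinarith
        nlinarith
      · nlinarith [mul_nonneg ht hc.le, mul_pos hd (neg_pos.2 hb)]
    · have hdc : c ≤ d := by nlinarith
      nlinarith

/-- A unit-speed curve `(x, y)` that is projectable onto its chord, the segment from `(0, y u)`
to `(L, y u)`, cannot have the sine `w` of its tangent angle everywhere above the sine of the
tangent angle of a circular arc with the same chord. -/
lemma not_forall_circle_lt {x y p w : ℝ → ℝ} {u v L a : ℝ} (huv : u < v) (hL : 0 < L)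
    (hx : ∀ s, HasDerivAt x (p s) s) (hy : ∀ s, HasDerivAt y (w s) s)
    (hp : ∀ s ∈ Set.Icc u v, 0 < p s) (hpw : ∀ s, p s ^ 2 + w s ^ 2 = 1)
    (hxu : x u = 0) (hxv : x v = L) (hyuv : y u = y v) (ha : a ^ 2 < 1) :
    ¬ ∀ s ∈ Set.Ioo u v, a * (2 * x s / L - 1) < w s := by
  intro h
  have hxmono : StrictMonoOn x (Set.Icc u v) :=
    strictMonoOn_of_deriv_pos (convex_Icc u v) (fun s _ => (hx s).continuousAt.continuousWithinAt)
      fun s hs => by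
        rw [(hx s).deriv]
        exact hp s (interior_subset hs)
  have hpos : ∀ s ∈ Set.Icc u v, 0 < 1 - (a * (2 * x s / L - 1)) ^ 2 := by
    intro s hs
    have h0 : 0 ≤ x s / L := div_nonneg
      (hxu ▸ hxmono.monotoneOn (Set.left_mem_Icc.2 huv.le) hs hs.1) hL.le
    have h1 : x s / L ≤ 1 := (div_le_one hL).2
      (hxv ▸ hxmono.monotoneOn hs (Set.right_mem_Icc.2 huv.le) hs.2)
    have h2 : (2 * x s / L - 1) ^ 2 ≤ 1 := by
      rw [mul_div_assoc]; nlinarith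
    rw [mul_pow]
    nlinarith [sq_nonneg a]
  set r : ℝ → ℝ := fun s => √(1 - (a * (2 * x s / L - 1)) ^ 2) with hr
  have hderiv : ∀ s ∈ Set.Icc u v, HasDerivAt (fun s => y s + L / (2 * a) * r s)
      (w s - p s * (a * (2 * x s / L - 1)) / r s) s := by
    intro s hs
    have h1 := (((((hx s).const_mul 2).div_const L).sub_const 1).const_mul a).pow 2
    have h2 := (h1.const_sub 1).sqrt (hpos s hs).ne'
    refine ((hy s).add (h2.const_mul (L / (2 * a)))).congr_deriv ?_
    have hr0 : r s ≠ 0 := (Real.sqrt_pos.2 (hpos s hs)).ne'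
    change w s + L / (2 * a) * (_ / (2 * r s)) = _
    rcases eq_or_ne a 0 with rfl | ha0
    · simp
    · simp
      field_simp
      ring
  have hmono : StrictMonoOn (fun s => y s + L / (2 * a) * r s) (Set.Icc u v) := by
    refine strictMonoOn_of_deriv_pos (convex_Icc u v)
      (fun s hs => (hderiv s hs).continuousAt.continuousWithinAt) fun s hs => ?_
    rw [interior_Icc] at hs
    have hs' := Set.Ioo_subset_Icc_self hs
    rw [(hderiv s hs').deriv, sub_pos]
    have hr0 : 0 < r s := Real.sqrt_pos.2 (hpos s hs')
    rw [div_lt_iff₀ hr0]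
    refine mul_lt_mul_of_unit_circle ?_ (hpw s) hr0 (hp s hs').le (h s hs)
    rw [hr]
    simp only
    rw [Real.sq_sqrt (hpos s hs').le]
    ring
  have := hmono (Set.left_mem_Icc.2 huv.le) (Set.right_mem_Icc.2 huv.le) huv
  simp only [hr, hxu, hxv, hyuv] at this
  rw [mul_div_assoc, mul_div_assoc, div_self hL.ne'] at this
  norm_num at this

/-- Boundary angle inequalities for an arc with nondecreasing curvature `k` that is projectable
onto its chord; `w` is the sine of the tangent angle relative to the chord. The last inequality
is the theorem of Vogt. -/
lemma boundary_angle_inequalities {x y p w k : ℝ → ℝ} {u v L : ℝ} (huv : u < v) (hL : 0 < L)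
    (hx : ∀ s, HasDerivAt x (p s) s) (hy : ∀ s, HasDerivAt y (w s) s)
    (hw : ∀ s, HasDerivAt w (k s * p s) s)
    (hp : ∀ s ∈ Set.Icc u v, 0 < p s) (hpw : ∀ s, p s ^ 2 + w s ^ 2 = 1)
    (hxu : x u = 0) (hxv : x v = L) (hyuv : y u = y v) (hk : MonotoneOn k (Set.Icc u v)) :
    2 * w v / L ≤ k v ∧ k u ≤ -(2 * w u / L) ∧ 0 ≤ w u + w v := by
  have hu : u ∈ Set.Icc u v := Set.left_mem_Icc.2 huv.le
  have hv : v ∈ Set.Icc u v := Set.right_mem_Icc.2 huv.le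
  have hwu : w u ^ 2 < 1 := by nlinarith [hp u hu, hpw u]
  have hwv : w v ^ 2 < 1 := by nlinarith [hp v hv, hpw v]
  have hg : ∀ a s, HasDerivAt (fun s => w s - a * (2 * x s / L - 1))
      ((k s - 2 * a / L) * p s) s := fun a s => by
    refine ((hw s).sub
      (((((hx s).const_mul 2).div_const L).sub_const 1).const_mul a)).congr_deriv ?_
    ring
  have hgc : ∀ a (S : Set ℝ), ContinuousOn (fun s => w s - a * (2 * x s / L - 1)) S :=
    fun a S s _ => (hg a s).continuousAt.continuousWithinAt
  refine ⟨?_, ?_, ?_⟩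
  · by_contra! hlt
    refine not_forall_circle_lt huv hL hx hy hp hpw hxu hxv hyuv hwv fun s hs => ?_
    have hanti : StrictAntiOn (fun s => w s - w v * (2 * x s / L - 1)) (Set.Icc u v) := by
      refine strictAntiOn_of_deriv_neg (convex_Icc u v) (hgc _ _) fun s hs => ?_
      have hs := interior_subset hs
      rw [(hg _ s).deriv]
      exact mul_neg_of_neg_of_pos (by linarith [hk hs hv hs.2]) (hp s hs)
    have := hanti (Set.Ioo_subset_Icc_self hs) hv hs.2
    simp only [hxv, mul_div_assoc, div_self hL.ne'] at this ⊢
    linarith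
  · by_contra! hlt
    refine not_forall_circle_lt (a := -w u) huv hL hx hy hp hpw hxu hxv hyuv (by simpa using hwu)
      fun s hs => ?_
    have hmono : StrictMonoOn (fun s => w s - -w u * (2 * x s / L - 1)) (Set.Icc u v) := by
      refine strictMonoOn_of_deriv_pos (convex_Icc u v) (hgc _ _) fun s hs => ?_
      have hs := interior_subset hs
      rw [(hg _ s).deriv]
      refine mul_pos ?_ (hp s hs)
      have : 2 * -w u / L = -(2 * w u / L) := by ring
      linarith [hk hu hs hs.1]
    have := hmono hu (Set.Ioo_subset_Icc_self hs) hs.1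
    simp only [hxu, mul_zero, zero_div] at this
    linarith
  · by_contra! hlt
    set a := (w v - w u) / 2 with ha
    refine not_forall_circle_lt (y := fun s => -y s) (w := fun s => -w s) (a := -a) huv hL hx
      (fun s => (hy s).neg) hp (by simpa using hpw) hxu hxv (by simpa using hyuv)
      (by rw [ha]; nlinarith [sq_nonneg (w u + w v)]) fun s hs => ?_
    by_contra! hge
    obtain ⟨c, hc, hceq⟩ := exists_hasDerivAt_eq_slope _ _ hs.1 (hgc a _) fun t _ => hg a t
    obtain ⟨d, hd, hdeq⟩ := exists_hasDerivAt_eq_slope _ _ hs.2 (hgc a _) fun t _ => hg a t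
    have hcI : c ∈ Set.Icc u v := ⟨hc.1.le, hc.2.le.trans hs.2.le⟩
    have hdI : d ∈ Set.Icc u v := ⟨hs.1.le.trans hd.1.le, hd.2.le⟩
    have h1 : 0 < k c - 2 * a / L := by
      refine pos_of_mul_pos_left (b := p c) ?_ (hp c hcI).le
      rw [hceq]
      refine div_pos ?_ (sub_pos.2 hs.1)
      simp only [hxu, mul_zero, zero_div]
      linarith
    have h2 : k d - 2 * a / L < 0 := by
      refine neg_of_mul_neg_left (b := p d) ?_ (hp d hdI).le
      rw [hdeq]
      refine div_neg_of_neg_of_pos ?_ (sub_pos.2 hs.2)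
      simp only [hxv, mul_div_assoc, div_self hL.ne'] at hge ⊢
      linarith
    linarith [hk hcI hdI (hc.2.trans hd.1).le]

lemma norm_sq_eq_coords (a : EuclideanSpace ℝ (Fin 2)) : ‖a‖ ^ 2 = a 0 ^ 2 + a 1 ^ 2 := by
  simp [EuclideanSpace.norm_sq_eq]

lemma inner_eq_coords (a b : EuclideanSpace ℝ (Fin 2)) : ⟪a, b⟫_ℝ = a 0 * b 0 + a 1 * b 1 := by
  simp [PiLp.inner_apply, Fin.sum_univ_two, mul_comm]

lemma hasDerivAt_coord {f : ℝ → EuclideanSpace ℝ (Fin 2)} {f' : EuclideanSpace ℝ (Fin 2)} {s : ℝ}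
    (h : HasDerivAt f f' s) (i : Fin 2) : HasDerivAt (fun t => f t i) (f' i) s :=
  ((EuclideanSpace.proj (𝕜 := ℝ) i).hasFDerivAt.comp_hasDerivAt s h :)

/-- For an arc of a spiral that is projectable onto its chord: the circle through the endpoints
tangent to the arc at its end (start) has curvature at most (at least) that of the arc there,
and the sines of the boundary angles have nonnegative sum. -/
lemma chord_tangent_inequalities {γ : ℝ → EuclideanSpace ℝ (Fin 2)} (hγ : ContDiff ℝ 2 γ)
    (hunit : ∀ s, ‖deriv γ s‖ = 1) {u v : ℝ} (huv : u < v)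
    (hk : MonotoneOn (signedCurv γ) (Set.Icc u v)) {V : EuclideanSpace ℝ (Fin 2)}
    (hV : V = γ v - γ u) (hV0 : 0 < ‖V‖)
    (hproj : ∀ s ∈ Set.Icc u v, 0 < ⟪deriv γ s, ‖V‖⁻¹ • V⟫_ℝ) :
    2 * det2 V (deriv γ v) / ‖V‖ ^ 2 ≤ signedCurv γ v ∧
      signedCurv γ u ≤ 2 * det2 (deriv γ u) V / ‖V‖ ^ 2 ∧
      det2 (deriv γ u) V / ‖V‖ ≤ det2 V (deriv γ v) / ‖V‖ := by
  have hγ1 : ∀ s, HasDerivAt γ (deriv γ s) s := fun s =>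
    (hγ.differentiable (by norm_num) s).hasDerivAt
  have hγ2 : ∀ s, HasDerivAt (deriv γ) (deriv (deriv γ) s) s := fun s =>
    ((hγ.deriv' (n := 1)).differentiable (by norm_num) s).hasDerivAt
  have hT : ∀ s, deriv γ s 0 ^ 2 + deriv γ s 1 ^ 2 = 1 := fun s => by
    rw [← norm_sq_eq_coords, hunit, one_pow]
  have horth : ∀ s, deriv γ s 0 * deriv (deriv γ) s 0 + deriv γ s 1 * deriv (deriv γ) s 1 = 0 := by
    intro s
    have h1 := ((hasDerivAt_coord (hγ2 s) 0).pow 2).add ((hasDerivAt_coord (hγ2 s) 1).pow 2)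
    have h2 := h1.unique ((hasDerivAt_const s (1 : ℝ)).congr_of_eventuallyEq
      (Filter.Eventually.of_forall hT))
    norm_num at h2
    linarith
  set L := ‖V‖ with hLdef
  have hLsq : V 0 ^ 2 + V 1 ^ 2 = L ^ 2 := (norm_sq_eq_coords V).symm
  have hVi : ∀ i, γ v i - γ u i = V i := fun i => by rw [hV]; rfl
  obtain ⟨h1, h2, h3⟩ := boundary_angle_inequalities (L := L) (k := signedCurv γ)
    (x := fun s => (γ s 0 - γ u 0) * (V 0 / L) + (γ s 1 - γ u 1) * (V 1 / L))
    (y := fun s => (V 0 / L) * (γ s 1 - γ u 1) - (V 1 / L) * (γ s 0 - γ u 0))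
    (p := fun s => deriv γ s 0 * (V 0 / L) + deriv γ s 1 * (V 1 / L))
    (w := fun s => (V 0 / L) * deriv γ s 1 - (V 1 / L) * deriv γ s 0) huv hV0
    (fun s => (((hasDerivAt_coord (hγ1 s) 0).sub_const _).mul_const _).add
      (((hasDerivAt_coord (hγ1 s) 1).sub_const _).mul_const _))
    (fun s => (((hasDerivAt_coord (hγ1 s) 1).sub_const _).const_mul _).sub
      (((hasDerivAt_coord (hγ1 s) 0).sub_const _).const_mul _))
    (fun s => by
      refine (((hasDerivAt_coord (hγ2 s) 1).const_mul _).sub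
        ((hasDerivAt_coord (hγ2 s) 0).const_mul _)).congr_deriv ?_
      rw [signedCurv, det2]
      linear_combination (V 0 / L * deriv γ s 1 - V 1 / L * deriv γ s 0) * horth s -
        (V 0 / L * deriv (deriv γ) s 1 - V 1 / L * deriv (deriv γ) s 0) * hT s)
    (fun s hs => by
      have := hproj s hs
      rw [inner_eq_coords] at this
      simpa [div_eq_inv_mul] using this)
    (fun s => by
      field_simp
      linear_combination (deriv γ s 0 ^ 2 + deriv γ s 1 ^ 2) * hLsq + L ^ 2 * hT s)
    (by simp)
    (by
      simp only [hVi]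
      field_simp
      exact hLsq)
    (by
      simp only [hVi, sub_self, mul_zero]
      ring)
    hk
  simp only [det2]
  refine ⟨le_of_eq_of_le ?_ h1, h2.trans_eq ?_, ?_⟩
  · field_simp
  · field_simp
    ring
  · rw [← sub_nonneg]
    refine h3.trans_eq ?_
    ring

/-- If the circle through `A` and `B = A + v₁` tangent to `T` at `B` is curved no more than the
circle through `B` and `B + v₂` tangent to `T` at `B`, then the latter is curved at least as
much as the circle through the three points, whose arc `AB` is at most a half circle. -/
lemma three_point_le_tangent_circle {v₁ v₂ T : EuclideanSpace ℝ (Fin 2)} (hT : ‖T‖ = 1)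
    (h₁ : 0 < ‖v₁‖) (h₂ : 0 < ‖v₂‖) (h₁₂ : 0 < ‖v₁ + v₂‖) (hT₂ : 0 < ⟪T, v₂⟫_ℝ)
    (hturn : 0 ≤ ‖v₁‖ ^ 2 + ⟪v₁, v₂⟫_ℝ)
    (hle : det2 v₁ T / ‖v₁‖ ^ 2 ≤ det2 T v₂ / ‖v₂‖ ^ 2) :
    det2 v₁ v₂ / (‖v₁‖ * ‖v₁ + v₂‖) ≤ det2 T v₂ / ‖v₂‖ := by
  by_contra! hlt
  have hTsq : T 0 ^ 2 + T 1 ^ 2 = 1 := by rw [← norm_sq_eq_coords, hT, one_pow]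
  have e₁ := norm_sq_eq_coords v₁
  have e₂ := norm_sq_eq_coords v₂
  have e₁₂ := norm_sq_eq_coords (v₁ + v₂)
  simp only [PiLp.add_apply] at e₁₂
  have key := mul_lt_mul_of_unit_circle (c := ⟪T, v₂⟫_ℝ / ‖v₂‖)
    (d := (‖v₁‖ ^ 2 + ⟪v₁, v₂⟫_ℝ) / (‖v₁‖ * ‖v₁ + v₂‖))
    (by
      rw [inner_eq_coords, det2]
      field_simp
      rw [e₂]
      linear_combination (v₂ 0 ^ 2 + v₂ 1 ^ 2) * hTsq)
    (by
      rw [inner_eq_coords, det2]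
      field_simp
      rw [e₁₂, e₁]
      ring)
    (div_pos hT₂ h₂) (div_nonneg hturn (mul_pos h₁ h₁₂).le) hlt
  rw [div_mul_div_comm, div_mul_div_comm, div_lt_div_iff_of_pos_right (by positivity)] at key
  rw [div_le_div_iff₀ (by positivity) (by positivity)] at hle
  have hid : det2 v₁ v₂ * ⟪T, v₂⟫_ℝ = ⟪v₁, v₂⟫_ℝ * det2 T v₂ + ‖v₂‖ ^ 2 * det2 v₁ T := by
    rw [e₂, inner_eq_coords, inner_eq_coords]
    simp only [det2]
    ring
  linarith

/-- Proposition 2: on a spiral, under the turning-angle constraints, the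
signed three-point curvatures of consecutive node triples are ordered. -/
theorem prop2_three_point_curvatures_monotone
    (γ : ℝ → EuclideanSpace ℝ (Fin 2)) (hγ : ContDiff ℝ 2 γ)
    (hunit : ∀ s, ‖deriv γ s‖ = 1)
    (s₁ s₂ s₃ s₄ : ℝ) (h12 : s₁ < s₂) (h23 : s₂ < s₃) (h34 : s₃ < s₄)
    (hmono : MonotoneOn (signedCurv γ) (Set.Icc s₁ s₄))
    (P₁ P₂ P₃ P₄ : EuclideanSpace ℝ (Fin 2))
    (hP₁ : P₁ = γ s₁) (hP₂ : P₂ = γ s₂) (hP₃ : P₃ = γ s₃) (hP₄ : P₄ = γ s₄)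
    (hdist : ([P₁, P₂, P₃, P₄] : List (EuclideanSpace ℝ (Fin 2))).Pairwise (· ≠ ·))
    (v₁ v₂ v₃ : EuclideanSpace ℝ (Fin 2))
    (hv₁ : v₁ = P₂ - P₁) (hv₂ : v₂ = P₃ - P₂) (hv₃ : v₃ = P₄ - P₃)
    (hproj₁ : ∀ s ∈ Set.Icc s₁ s₂, 0 < ⟪deriv γ s, ‖v₁‖⁻¹ • v₁⟫_ℝ)
    (hproj₂ : ∀ s ∈ Set.Icc s₂ s₃, 0 < ⟪deriv γ s, ‖v₂‖⁻¹ • v₂⟫_ℝ)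
    (hproj₃ : ∀ s ∈ Set.Icc s₃ s₄, 0 < ⟪deriv γ s, ‖v₃‖⁻¹ • v₃⟫_ℝ)
    (hturn₁ : 0 ≤ ‖v₁‖ ^ 2 + ⟪v₁, v₂⟫_ℝ)
    (hturn₂ : 0 ≤ ‖v₃‖ ^ 2 + ⟪v₂, v₃⟫_ℝ) :
    q3 P₁ P₂ P₃ ≤ q3 P₂ P₃ P₄ := by
  obtain ⟨⟨d12, d13, -⟩, ⟨d23, d24⟩, d34⟩ :
      (P₁ ≠ P₂ ∧ P₁ ≠ P₃ ∧ P₁ ≠ P₄) ∧ (P₂ ≠ P₃ ∧ P₂ ≠ P₄) ∧ P₃ ≠ P₄ := by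
    simpa using hdist
  have n₁ : 0 < ‖v₁‖ := by rw [hv₁]; exact norm_pos_iff.2 (sub_ne_zero.2 d12.symm)
  have n₂ : 0 < ‖v₂‖ := by rw [hv₂]; exact norm_pos_iff.2 (sub_ne_zero.2 d23.symm)
  have n₃ : 0 < ‖v₃‖ := by rw [hv₃]; exact norm_pos_iff.2 (sub_ne_zero.2 d34.symm)
  have e₁₂ : P₃ - P₁ = v₁ + v₂ := by rw [hv₁, hv₂]; abel
  have e₃₂ : P₄ - P₂ = v₃ + v₂ := by rw [hv₃, hv₂]; abel
  have n₁₂ : 0 < ‖v₁ + v₂‖ := by rw [← e₁₂]; exact norm_pos_iff.2 (sub_ne_zero.2 d13.symm)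
  have n₃₂ : 0 < ‖v₃ + v₂‖ := by rw [← e₃₂]; exact norm_pos_iff.2 (sub_ne_zero.2 d24.symm)
  obtain ⟨a₁, -, -⟩ := chord_tangent_inequalities hγ hunit h12
    (hmono.mono (Set.Icc_subset_Icc le_rfl (h23.trans h34).le))
    (hv₁.trans (by rw [hP₁, hP₂])) n₁ hproj₁
  obtain ⟨a₂, b₂, c₂⟩ := chord_tangent_inequalities hγ hunit h23
    (hmono.mono (Set.Icc_subset_Icc h12.le h34.le))
    (hv₂.trans (by rw [hP₂, hP₃])) n₂ hproj₂
  obtain ⟨-, b₃, -⟩ := chord_tangent_inequalities hγ hunit h34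
    (hmono.mono (Set.Icc_subset_Icc (h12.trans h23).le le_rfl))
    (hv₃.trans (by rw [hP₃, hP₄])) n₃ hproj₃
  have hproj : ∀ s ∈ Set.Icc s₂ s₃, 0 < ⟪deriv γ s, v₂⟫_ℝ := fun s hs => by
    have := hproj₂ s hs
    rw [real_inner_smul_right] at this
    exact pos_of_mul_pos_right this (inv_pos.2 n₂).le
  have swap : ∀ a b, det2 a b = -det2 b a := fun a b => by simp only [det2]; ring
  have left := three_point_le_tangent_circle (hunit s₂) n₁ n₂ n₁₂
    (hproj _ (Set.left_mem_Icc.2 h23.le)) hturn₁ (by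
      have := a₁.trans b₂
      rw [mul_div_assoc, mul_div_assoc] at this
      linarith)
  have right := three_point_le_tangent_circle (hunit s₃) n₃ n₂ n₃₂
    (hproj _ (Set.right_mem_Icc.2 h23.le)) (by rwa [real_inner_comm]) (by
      have := a₂.trans b₃
      rw [swap v₃, swap (deriv γ s₃) v₂, neg_div, neg_div, neg_le_neg_iff]
      rw [mul_div_assoc, mul_div_assoc] at this
      linarith)
  rw [swap v₃, swap (deriv γ s₃) v₂, neg_div, neg_div, neg_le_neg_iff] at right
  have hq : det2 v₁ v₂ / (‖v₁‖ * ‖v₁ + v₂‖) ≤ det2 v₂ v₃ / (‖v₃‖ * ‖v₃ + v₂‖) :=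
    left.trans (c₂.trans right)
  rw [q3, q3, ← hv₁, ← hv₂, ← hv₃, e₁₂, e₃₂]
  calc 2 * det2 v₁ v₂ / (‖v₁‖ * ‖v₂‖ * ‖v₁ + v₂‖)
      = 2 / ‖v₂‖ * (det2 v₁ v₂ / (‖v₁‖ * ‖v₁ + v₂‖)) := by field_simp
    _ ≤ 2 / ‖v₂‖ * (det2 v₂ v₃ / (‖v₃‖ * ‖v₃ + v₂‖)) := by gcongr
    _ = 2 * det2 v₂ v₃ / (‖v₂‖ * ‖v₃‖ * ‖v₃ + v₂‖) := by field_simp
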